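/- Let k ≥ 4 and let C* ∈ F*(K_3^{+k}, C_{t_k}) with underlying tight cycle C*_{t_k} whose vertices are labelled 0, …, t_k-1 so that e_i = {i, i+1, …, i+k-1} (indices modulo t_k) for 0 ≤ i ≤ t_k-1, with attachment edge e_0, and for 1 ≤ i ≤ t_k-1 let F^i ⊆ C* be the copy of K_3^{+k} containing e_i. Suppose an edge e of C* belongs to F^i, F^j and F^ℓ for some 1 ≤ i < j < ℓ ≤ t_k-1. Then j = i+1 and ℓ = i+2, and e equals one of the sets {i, i+2, …, i+k}, {i+1, …, i+k-1, i+k+1}, or e_{i+1}; in particular e ⊆ V(C*_{t_k}). -/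

import Mathlib

open scoped Classical

namespace ARR

/-- The vertex support of a hypergraph given by its edge set. -/
def vset (G : Finset (Finset ℕ)) : Finset ℕ := G.sup id

/-- Number of vertices of a hypergraph. -/
def vcount (G : Finset (Finset ℕ)) : ℕ := (vset G).card

/-- `G` is a `k`-uniform hypergraph. -/
def IsUniform (k : ℕ) (G : Finset (Finset ℕ)) : Prop := ∀ e ∈ G, e.card = k

/-- The `k`-density `d_k`. -/
noncomputable def dk (k : ℕ) (G : Finset (Finset ℕ)) : ℝ :=
  if G.card = 0 then 0
  else if G.card = 1 ∧ vcount G = k then 1 / (k : ℝ)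
  else ((G.card : ℝ) - 1) / ((vcount G : ℝ) - (k : ℝ))

/-- The `k`-density `m_k`: the maximum of `d_k` over subgraphs. -/
noncomputable def mk (k : ℕ) (G : Finset (Finset ℕ)) : ℝ :=
  sSup {x : ℝ | ∃ H ⊆ G, x = dk k H}

/-- The usual density `m(G)`. -/
noncomputable def mDens (G : Finset (Finset ℕ)) : ℝ :=
  sSup {x : ℝ | ∃ H ⊆ G, 1 ≤ vcount H ∧ x = (H.card : ℝ) / (vcount H : ℝ)}

/-- `G` is strictly `k`-balanced: every proper subgraph has strictly smaller `k`-density. -/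
def StrictlyKBalanced (k : ℕ) (G : Finset (Finset ℕ)) : Prop :=
  ∀ H ⊆ G, H ≠ G → dk k H < dk k G

/-- The asymmetric `k`-density `m_k(F₁,F₂)`. -/
noncomputable def mkA (k : ℕ) (F1 F2 : Finset (Finset ℕ)) : ℝ :=
  sSup {x : ℝ | ∃ H ⊆ F1, H.Nonempty ∧
    x = (H.card : ℝ) / ((vcount H : ℝ) - (k : ℝ) + 1 / mk k F2)}

/-- `F₁` is strictly balanced with respect to `m_k(·, F₂)`. -/
def StrictlyBalancedWrt (k : ℕ) (F1 F2 : Finset (Finset ℕ)) : Prop :=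
  ∀ H ⊆ F1, H.Nonempty → H ≠ F1 →
    (H.card : ℝ) / ((vcount H : ℝ) - (k : ℝ) + 1 / mk k F2) < mkA k F1 F2

/-- `F'` is a copy of `F` (an isomorphic image of `F`). -/
def IsCopy (F F' : Finset (Finset ℕ)) : Prop :=
  ∃ f : ℕ → ℕ, Set.InjOn f ↑(vset F) ∧ F' = F.image (Finset.image f)

/-- `G` contains a copy of `F`. -/
def ContainsCopy (G F : Finset (Finset ℕ)) : Prop := ∃ F' ⊆ G, IsCopy F F'

/-- Asymmetric Ramsey arrow `G → (F₁, …, F_r)`. -/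
def Arrow {r : ℕ} (G : Finset (Finset ℕ)) (F : Fin r → Finset (Finset ℕ)) : Prop :=
  ∀ χ : Finset ℕ → Fin r, ∃ i : Fin r, ∃ F' ⊆ G, IsCopy (F i) F' ∧ ∀ e ∈ F', χ e = i

/-- Symmetric Ramsey arrow `G → (F)_r`. -/
def ArrowSym (G F : Finset (Finset ℕ)) (r : ℕ) : Prop :=
  ∀ χ : Finset ℕ → Fin r, ∃ i : Fin r, ∃ F' ⊆ G, IsCopy F F' ∧ ∀ e ∈ F', χ e = i

/-- Two-colour asymmetric arrow `G → (F₁, F₂)`. -/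
def Arrow2 (G F1 F2 : Finset (Finset ℕ)) : Prop :=
  ∀ χ : Finset ℕ → Fin 2,
    (∃ F' ⊆ G, IsCopy F1 F' ∧ ∀ e ∈ F', χ e = 0) ∨
    (∃ F' ⊆ G, IsCopy F2 F' ∧ ∀ e ∈ F', χ e = 1)

/-- The edge set of the complete `k`-uniform hypergraph on `{0, …, n-1}`. -/
def allEdges (k n : ℕ) : Finset (Finset ℕ) := (Finset.range n).powersetCard k

/-- Probability that the binomial random hypergraph `H^k(n,p)` satisfies property `P`. -/
noncomputable def prob (k n : ℕ) (p : ℝ) (P : Finset (Finset ℕ) → Prop) : ℝ :=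
  ∑ G ∈ (allEdges k n).powerset,
    if P G then p ^ G.card * (1 - p) ^ ((allEdges k n).card - G.card) else 0

/-- Expected number of members of a family `𝓕` which appear as subgraphs of `H^k(n,p)`. -/
noncomputable def expectCount (k n : ℕ) (p : ℝ) (𝓕 : Finset (Finset (Finset ℕ))) : ℝ :=
  ∑ G ∈ (allEdges k n).powerset,
    (p ^ G.card * (1 - p) ^ ((allEdges k n).card - G.card)) *
      ((𝓕.filter (fun F => F ⊆ G)).card : ℝ)

/-- `K₃^{+k}`: the triangle on `{0,1,2}` with the `k-2` vertices `{3,…,k}` added to each edge. -/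
def K3plus (k : ℕ) : Finset (Finset ℕ) :=
  {({0, 1} : Finset ℕ) ∪ (Finset.range (k + 1)).filter (fun x => 3 ≤ x),
   ({0, 2} : Finset ℕ) ∪ (Finset.range (k + 1)).filter (fun x => 3 ≤ x),
   ({1, 2} : Finset ℕ) ∪ (Finset.range (k + 1)).filter (fun x => 3 ≤ x)}

/-- The `i`-th edge `{i, i+1, …, i+k-1}` (mod `t`) of the tight cycle on `t` vertices. -/
def cycEdge (k t i : ℕ) : Finset ℕ := (Finset.range k).image (fun j => (i + j) % t)

/-- The tight cycle `C_t` (k-uniform) on vertex set `{0, …, t-1}`. -/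
def tightCycle (k t : ℕ) : Finset (Finset ℕ) := (Finset.range t).image (cycEdge k t)

/-- The tight path `T^k_ℓ` on vertex set `{0, …, ℓ-1}`. -/
def tightPath (k l : ℕ) : Finset (Finset ℕ) :=
  (Finset.range (l - k + 1)).image (fun i => (Finset.range k).image (fun j => i + j))

/-- The cycle length `t_k`: `t₄ = 8`, `t₅ = 14`, and `t_k = k²` for `k ≥ 6`. -/
def tk (k : ℕ) : ℕ := if k = 4 then 8 else if k = 5 then 14 else k ^ 2

/-- Shift all vertices of a hypergraph by `a` (used to form vertex-disjoint unions). -/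
def shiftHG (a : ℕ) (G : Finset (Finset ℕ)) : Finset (Finset ℕ) :=
  G.image (Finset.image (· + a))

/-- A set of edges is `m`-intersecting if any two distinct edges meet in at most `m` vertices. -/
def IntersectingLE (m : ℕ) (S : Finset (Finset ℕ)) : Prop :=
  ∀ e ∈ S, ∀ f ∈ S, e ≠ f → (e ∩ f).card ≤ m

/-- `e₀` is an attachment edge of `Fst` as a member of the family `F*(F₁,F₂)`. -/
def IsAttachment (F1 F2 Fst : Finset (Finset ℕ)) (e0 : Finset ℕ) : Prop :=
  ∃ F2' : Finset (Finset ℕ), e0 ∈ F2' ∧ IsCopy F2 F2' ∧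
    ∃ g : Finset ℕ → Finset (Finset ℕ),
      (∀ e ∈ F2'.erase e0, IsCopy F1 (g e) ∧ e ∈ g e) ∧
      Fst = F2' ∪ (F2'.erase e0).biUnion g

/-- `Fst` is a member of the family `F*(F₁,F₂)`. -/
def IsFStar (F1 F2 Fst : Finset (Finset ℕ)) : Prop := ∃ e0, IsAttachment F1 F2 Fst e0

/-- `Fst` is a generic member of `F*(F₁,F₂)`. -/
def IsGeneric (F1 F2 Fst : Finset (Finset ℕ)) : Prop :=
  ∃ F2' : Finset (Finset ℕ), ∃ e0 ∈ F2', IsCopy F2 F2' ∧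
    ∃ g : Finset ℕ → Finset (Finset ℕ),
      (∀ e ∈ F2'.erase e0, IsCopy F1 (g e) ∧ e ∈ g e) ∧
      Fst = F2' ∪ (F2'.erase e0).biUnion g ∧
      (∀ e ∈ F2'.erase e0, vset (g e) ∩ vset F2' = e) ∧
      (∀ e ∈ F2'.erase e0, ∀ e' ∈ F2'.erase e0, e ≠ e' →
        (vset (g e) \ e) ∩ (vset (g e') \ e') = ∅)

/-- The family `F*(F₁,F₂)` is asymmetric-balanced. -/
def AsymBalanced (k : ℕ) (F1 F2 : Finset (Finset ℕ)) : Prop :=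
  ∀ Fst, IsFStar F1 F2 Fst →
    ∀ H ⊆ Fst, vset H ⊂ vset Fst → (∃ e0 ∈ H, IsAttachment F1 F2 Fst e0) →
      mkA k F1 F2 ≤ ((Fst.card : ℝ) - (H.card : ℝ)) / ((vcount Fst : ℝ) - (vcount H : ℝ)) ∧
      (((Fst.card : ℝ) - (H.card : ℝ)) / ((vcount Fst : ℝ) - (vcount H : ℝ)) = mkA k F1 F2 →
        (∃ e0, IsAttachment F1 F2 Fst e0 ∧ H = {e0}) ∧ IsGeneric F1 F2 Fst)

/-- An edge `e` of `G` is closed (w.r.t. `F₁`, `F₂`): it lies in a copy of `F₁` and a copy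
of `F₂` inside `G` whose edge sets intersect exactly in `{e}`. -/
def ClosedEdge (F1 F2 G : Finset (Finset ℕ)) (e : Finset ℕ) : Prop :=
  ∃ A ⊆ G, ∃ B ⊆ G, IsCopy F1 A ∧ IsCopy F2 B ∧ A ∩ B = {e}

/-- Every edge of `G` is closed within `G`. -/
def SelfClosed (F1 F2 G : Finset (Finset ℕ)) : Prop := ∀ e ∈ G, ClosedEdge F1 F2 G e

/-- `Ĥ`: the subgraph of `H` obtained by repeatedly deleting open edges; equivalently the
largest subgraph of `H` all of whose edges are closed within it. -/
noncomputable def hatH (F1 F2 H : Finset (Finset ℕ)) : Finset (Finset ℕ) :=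
  (H.powerset.filter (fun G => SelfClosed F1 F2 G)).sup id

/-- `G'` is an `(F₁,F₂)`-core of `Ĥ`. -/
def IsCore (F1 F2 H G' : Finset (Finset ℕ)) : Prop :=
  G' ⊆ hatH F1 F2 H ∧
    ∀ A ⊆ hatH F1 F2 H, (IsCopy F1 A ∨ IsCopy F2 A) → (A ⊆ G' ∨ A ∩ G' = ∅)

/-- `G'` is a minimal (nonempty) closed `(F₁,F₂)`-core of `Ĥ`. -/
def IsMinimalCore (F1 F2 H G' : Finset (Finset ℕ)) : Prop :=
  G'.Nonempty ∧ IsCore F1 F2 H G' ∧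
    ∀ G'' ⊆ G', G''.Nonempty → G'' ≠ G' → ¬ IsCore F1 F2 H G''


lemma copy_diff {k : ℕ} {G : Finset (Finset ℕ)} (h : IsCopy (K3plus k) G) {x y : Finset ℕ}
    (hx : x ∈ G) (hy : y ∈ G) {a b : ℕ} (ha : a ∈ x) (hb : b ∈ x) (ha' : a ∉ y) (hb' : b ∉ y) :
    a = b := by
  obtain ⟨f, -, rfl⟩ := h
  obtain ⟨X, hX, rfl⟩ := Finset.mem_image.1 hx
  obtain ⟨Y, hY, rfl⟩ := Finset.mem_image.1 hy
  obtain ⟨a, ha, rfl⟩ := Finset.mem_image.1 ha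
  obtain ⟨b, hb, rfl⟩ := Finset.mem_image.1 hb
  have h1 : a ∉ Y := fun h => ha' (Finset.mem_image_of_mem f h)
  have h2 : b ∉ Y := fun h => hb' (Finset.mem_image_of_mem f h)
  congr 1
  simp only [K3plus, Finset.mem_insert, Finset.mem_singleton] at hX hY
  rcases hX with rfl | rfl | rfl <;> rcases hY with rfl | rfl | rfl <;>
    simp only [Finset.mem_union, Finset.mem_insert, Finset.mem_singleton, Finset.mem_filter,
      Finset.mem_range] at ha hb h1 h2 <;> clear ha' hb' hx hy <;> grind

lemma mem_cyc {k t m x : ℕ} (hm : m < t) (hk : k ≤ t) :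
    x ∈ cycEdge k t m ↔ x < t ∧ (m ≤ x ∧ x < m + k ∨ x + t < m + k) := by
  simp only [cycEdge, Finset.mem_image, Finset.mem_range]
  constructor
  · rintro ⟨j, hj, rfl⟩
    refine ⟨Nat.mod_lt _ (by omega), ?_⟩
    by_cases h : m + j < t
    · rw [Nat.mod_eq_of_lt h]; omega
    · rw [Nat.mod_eq_sub_mod (by omega), Nat.mod_eq_of_lt (by omega)]; omega
  · rintro ⟨hx, h | h⟩
    · exact ⟨x - m, by omega, by rw [Nat.mod_eq_of_lt (by omega)]; omega⟩
    · refine ⟨x + t - m, by omega, ?_⟩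
      rw [show m + (x + t - m) = x + t by omega, Nat.add_mod_right, Nat.mod_eq_of_lt hx]

lemma modcase {i a t : ℕ} (hi : i < t) (ha : a < t) :
    (i + a < t ∧ (i + a) % t = i + a) ∨ (t ≤ i + a ∧ (i + a) % t = i + a - t) := by
  by_cases h : i + a < t
  · exact Or.inl ⟨h, Nat.mod_eq_of_lt h⟩
  · right
    refine ⟨by omega, ?_⟩
    rw [Nat.mod_eq_sub_mod (by omega), Nat.mod_eq_of_lt (by omega)]

lemma tk_ge {k : ℕ} (hk : 4 ≤ k) : 2 * k ≤ tk k := by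
  unfold tk
  split_ifs
  · omega
  · omega
  · nlinarith

lemma near {k t i j : ℕ} {e : Finset ℕ} (hk : 4 ≤ k) (ht : 2 * k ≤ t) (hij : i < j) (hj : j < t)
    (hA : ∀ a b, a ∈ cycEdge k t i → b ∈ cycEdge k t i → a ∉ e → b ∉ e → a = b)
    (hB : ∀ a b, a ∈ e → b ∈ e → a ∉ cycEdge k t j → b ∉ cycEdge k t j → a = b) :
    j ≤ i + 2 ∨ i + t ≤ j + 2 := by
  by_contra hc
  have key : ∃ a, (a ∈ cycEdge k t i ∧ a ∉ cycEdge k t j) ∧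
      (a + 1 ∈ cycEdge k t i ∧ a + 1 ∉ cycEdge k t j) ∧
      (a + 2 ∈ cycEdge k t i ∧ a + 2 ∉ cycEdge k t j) := by
    simp only [mem_cyc (show i < t by omega) (show k ≤ t by omega),
      mem_cyc hj (show k ≤ t by omega)]
    by_cases h : j + k ≤ i + t
    · exact ⟨i, by omega, by omega, by omega⟩
    · exact ⟨i + k - 3, by omega, by omega, by omega⟩
  obtain ⟨a, ⟨h0, h0'⟩, ⟨h1, h1'⟩, ⟨h2, h2'⟩⟩ := key
  have := hA _ _ h0 h1
  have := hA _ _ h0 h2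
  have := hA _ _ h1 h2
  have := fun x y => hB _ _ x y h0' h1'
  have := fun x y => hB _ _ x y h0' h2'
  have := fun x y => hB _ _ x y h1' h2'
  by_cases a ∈ e <;> by_cases a + 1 ∈ e <;> by_cases a + 2 ∈ e <;> clear hA hB <;> grind


/-- if an edge of `C* ∈ F*(K₃^{+k}, C_{t_k})` lies in three of the attached
`K₃^{+k}`-copies `F^i, F^j, F^ℓ`, then these are consecutive and the edge has one of three
explicit shapes; in particular it lies inside the cycle's vertex set. -/
theorem three_copies (k : ℕ) (hk : 4 ≤ k)
    (Cst : Finset (Finset ℕ)) (g : ℕ → Finset (Finset ℕ)) (v : ℕ → ℕ)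
    (hg : ∀ i : ℕ, 1 ≤ i → i ≤ tk k - 1 →
      IsCopy (K3plus k) (g i) ∧ cycEdge k (tk k) i ∈ g i ∧ g i ⊆ Cst ∧
        vset (g i) = cycEdge k (tk k) i ∪ {v i})
    (hC : Cst = tightCycle k (tk k) ∪ (Finset.Icc 1 (tk k - 1)).biUnion g)
    (e : Finset ℕ) (he : e ∈ Cst)
    (i j l : ℕ) (hi : 1 ≤ i) (hij : i < j) (hjl : j < l) (hl : l ≤ tk k - 1)
    (hei : e ∈ g i) (hej : e ∈ g j) (hel : e ∈ g l) :
    j = i + 1 ∧ l = i + 2 ∧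
      (e = (insert 0 (Finset.Icc 2 k)).image (fun a => (i + a) % tk k) ∨
       e = ((Finset.Icc 1 (k - 1)) ∪ {k + 1}).image (fun a => (i + a) % tk k) ∨
       e = cycEdge k (tk k) (i + 1)) ∧
      e ⊆ Finset.range (tk k) := by
  have ht := tk_ge hk
  generalize tk k = t at *
  have hA : ∀ m, 1 ≤ m → m ≤ t - 1 → e ∈ g m →
      ∀ a b, a ∈ cycEdge k t m → b ∈ cycEdge k t m → a ∉ e → b ∉ e → a = b :=
    fun m h1 h2 h a b ha hb ha' hb' =>
      copy_diff (hg m h1 h2).1 (hg m h1 h2).2.1 h ha hb ha' hb'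
  have hB : ∀ m, 1 ≤ m → m ≤ t - 1 → e ∈ g m →
      ∀ a b, a ∈ e → b ∈ e → a ∉ cycEdge k t m → b ∉ cycEdge k t m → a = b :=
    fun m h1 h2 h a b ha hb ha' hb' =>
      copy_diff (hg m h1 h2).1 h (hg m h1 h2).2.1 ha hb ha' hb'
  have n1 := near hk ht hij (by omega) (hA i hi (by omega) hei) (hB j (by omega) (by omega) hej)
  have n2 := near hk ht hjl (by omega) (hA j (by omega) (by omega) hej)
    (hB l (by omega) (by omega) hel)
  have n3 := near hk ht (hij.trans hjl) (by omega) (hA i hi (by omega) hei)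
    (hB l (by omega) (by omega) hel)
  obtain rfl : j = i + 1 := by omega
  obtain rfl : l = i + 2 := by omega
  refine ⟨rfl, rfl, ?_⟩
  have hAi := hA i hi (by omega) hei
  have hBi := hB i hi (by omega) hei
  have hBj := hB (i+1) (by omega) (by omega) hej
  have hAl := hA (i+2) (by omega) (by omega) hel
  have hBl := hB (i+2) (by omega) (by omega) hel
  clear hA hB n1 n2 n3 hg hC hei hej hel he
  have hmem : ∀ d a, d ≤ 2 → a < k + 2 →
      ((i + a) % t ∈ cycEdge k t (i + d) ↔ d ≤ a ∧ a < k + d) := by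
    intro d a hd ha
    rw [mem_cyc (by omega) (by omega)]
    have := modcase (show i < t by omega) (show a < t by omega)
    omega
  have hinj : ∀ a b, a < k + 2 → b < k + 2 → (i + a) % t = (i + b) % t → a = b := by
    intro a b ha hb h
    have := modcase (show i < t by omega) (show a < t by omega)
    have := modcase (show i < t by omega) (show b < t by omega)
    omega
  have fA0 : ∀ a b, a < k → b < k → (i + a) % t ∉ e → (i + b) % t ∉ e → a = b := by
    intro a b ha hb h1 h2
    exact hinj a b (by omega) (by omega) (hAi _ _ ((hmem 0 a (by omega) (by omega)).2 (by omega))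
      ((hmem 0 b (by omega) (by omega)).2 (by omega)) h1 h2)
  have fA2 : ∀ a b, 2 ≤ a → 2 ≤ b → a < k + 2 → b < k + 2 →
      (i + a) % t ∉ e → (i + b) % t ∉ e → a = b := by
    intro a b ha hb ha' hb' h1 h2
    exact hinj a b (by omega) (by omega) (hAl _ _ ((hmem 2 a (by omega) (by omega)).2 (by omega))
      ((hmem 2 b (by omega) (by omega)).2 (by omega)) h1 h2)
  have fB0 : ∀ a b, k ≤ a → k ≤ b → a < k + 2 → b < k + 2 →
      (i + a) % t ∈ e → (i + b) % t ∈ e → a = b := by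
    intro a b ha hb ha' hb' h1 h2
    refine hinj a b (by omega) (by omega) (hBi _ _ h1 h2 ?_ ?_)
    · have := hmem 0 a (by omega) (by omega)
      simp only [add_zero] at this
      rw [this]; omega
    · have := hmem 0 b (by omega) (by omega)
      simp only [add_zero] at this
      rw [this]; omega
  have fB2 : ∀ a b, a < 2 → b < 2 → (i + a) % t ∈ e → (i + b) % t ∈ e → a = b := by
    intro a b ha hb h1 h2
    refine hinj a b (by omega) (by omega) (hBl _ _ h1 h2 ?_ ?_)
    · rw [hmem 2 a (by omega) (by omega)]; omega
    · rw [hmem 2 b (by omega) (by omega)]; omega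
  have fB1 : (i + 0) % t ∈ e → (i + (k + 1)) % t ∈ e → False := by
    intro h1 h2
    have := hinj 0 (k + 1) (by omega) (by omega) (hBj _ _ h1 h2
      (by rw [hmem 1 0 (by omega) (by omega)]; omega)
      (by rw [hmem 1 (k+1) (by omega) (by omega)]; omega))
    omega
  have hbase : ∀ a, 2 ≤ a → a < k → (i + a) % t ∈ e := by
    intro a h1 h2
    by_contra h
    have c0 : (i + 0) % t ∈ e := by
      by_contra h'
      have := fA0 a 0 h2 (by omega) h h'
      omega
    have c1 : (i + 1) % t ∈ e := by
      by_contra h'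
      have := fA0 a 1 h2 (by omega) h h'
      omega
    have := fB2 0 1 (by omega) (by omega) c0 c1
    omega
  have d01 : ((i + 0) % t ∈ e ∧ (i + 1) % t ∉ e) ∨ ((i + 0) % t ∉ e ∧ (i + 1) % t ∈ e) := by
    have h1 := fA0 0 1 (by omega) (by omega)
    have h2 := fB2 0 1 (by omega) (by omega)
    by_cases hP : (i + 0) % t ∈ e <;> by_cases hQ : (i + 1) % t ∈ e
    · exact absurd (h2 hP hQ) (by omega)
    · exact Or.inl ⟨hP, hQ⟩
    · exact Or.inr ⟨hP, hQ⟩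
    · exact absurd (h1 hP hQ) (by omega)
  have dk1 : ((i + k) % t ∈ e ∧ (i + (k + 1)) % t ∉ e) ∨
      ((i + k) % t ∉ e ∧ (i + (k + 1)) % t ∈ e) := by
    have h1 := fA2 k (k+1) (by omega) (by omega) (by omega) (by omega)
    have h2 := fB0 k (k+1) (by omega) (by omega) (by omega) (by omega)
    by_cases hP : (i + k) % t ∈ e <;> by_cases hQ : (i + (k + 1)) % t ∈ e
    · exact absurd (h2 hP hQ) (by omega)
    · exact Or.inl ⟨hP, hQ⟩
    · exact Or.inr ⟨hP, hQ⟩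
    · exact absurd (h1 hP hQ) (by omega)
  have hsub : ∀ x ∈ e, ∃ a < k + 2, x = (i + a) % t := by
    intro x hx
    by_cases hxi : x ∈ cycEdge k t i
    · simp only [cycEdge, Finset.mem_image, Finset.mem_range] at hxi
      obtain ⟨a, ha, rfl⟩ := hxi
      exact ⟨a, by omega, rfl⟩
    · have n0 := hmem 0 k (by omega) (by omega)
      have n1 := hmem 0 (k + 1) (by omega) (by omega)
      rw [add_zero i] at n0 n1
      rcases dk1 with ⟨h2, -⟩ | ⟨-, h2⟩
      · exact ⟨k, by omega, hBi _ _ hx h2 hxi (by rw [n0]; omega)⟩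
      · exact ⟨k + 1, by omega, hBi _ _ hx h2 hxi (by rw [n1]; omega)⟩
  have ext' : ∀ S : Finset ℕ, (∀ a ∈ S, a < k + 2) →
      (∀ a, a < k + 2 → ((i + a) % t ∈ e ↔ a ∈ S)) → e = S.image (fun a => (i + a) % t) := by
    intro S hS h
    ext x
    rw [Finset.mem_image]
    constructor
    · intro hx
      obtain ⟨a, ha, rfl⟩ := hsub x hx
      exact ⟨a, (h a ha).1 hx, rfl⟩
    · rintro ⟨a, ha, rfl⟩
      exact (h a (hS a ha)).2 ha
  have hcase : ∀ a, a < k + 2 → a = 0 ∨ a = 1 ∨ (2 ≤ a ∧ a < k) ∨ a = k ∨ a = k + 1 := by omega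
  refine ⟨?_, ?_⟩
  · rcases d01 with ⟨h0, h1⟩ | ⟨h0, h1⟩ <;> rcases dk1 with ⟨h2, h3⟩ | ⟨h2, h3⟩
    · left
      apply ext'
      · intro a; simp only [Finset.mem_insert, Finset.mem_Icc]; omega
      · intro a ha
        simp only [Finset.mem_insert, Finset.mem_Icc]
        rcases hcase a ha with rfl | rfl | h | rfl | rfl
        · exact iff_of_true h0 (by omega)
        · exact iff_of_false h1 (by omega)
        · exact iff_of_true (hbase a h.1 h.2) (by omega)
        · exact iff_of_true h2 (by omega)
        · exact iff_of_false h3 (by omega)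
    · exact (fB1 h0 h3).elim
    · right; right
      have : cycEdge k t (i + 1) = (Finset.Icc 1 k).image (fun a => (i + a) % t) := by
        ext x
        simp only [cycEdge, Finset.mem_image, Finset.mem_range, Finset.mem_Icc]
        constructor
        · rintro ⟨a, ha, rfl⟩
          exact ⟨a + 1, by omega, by congr 1; omega⟩
        · rintro ⟨a, ha, rfl⟩
          exact ⟨a - 1, by omega, by congr 1; omega⟩
      rw [this]
      apply ext'
      · intro a; simp only [Finset.mem_Icc]; omega
      · intro a ha
        simp only [Finset.mem_Icc]
        rcases hcase a ha with rfl | rfl | h | rfl | rfl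
        · exact iff_of_false h0 (by omega)
        · exact iff_of_true h1 (by omega)
        · exact iff_of_true (hbase a h.1 h.2) (by omega)
        · exact iff_of_true h2 (by omega)
        · exact iff_of_false h3 (by omega)
    · right; left
      apply ext'
      · intro a; simp only [Finset.mem_union, Finset.mem_singleton, Finset.mem_Icc]; omega
      · intro a ha
        simp only [Finset.mem_union, Finset.mem_singleton, Finset.mem_Icc]
        rcases hcase a ha with rfl | rfl | h | rfl | rfl
        · exact iff_of_false h0 (by omega)
        · exact iff_of_true h1 (by omega)
        · exact iff_of_true (hbase a h.1 h.2) (by omega)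
        · exact iff_of_false h2 (by omega)
        · exact iff_of_true h3 (by omega)
  · intro x hx
    obtain ⟨a, ha, rfl⟩ := hsub x hx
    exact Finset.mem_range.2 (Nat.mod_lt _ (by omega))

end ARR
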